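/- If A →_{HA₁/HA₂∪ℰ} B, then there exists an occurrence o of an atomic proposition in A, a proposition rewrite rule l → r of HA₁, and a substitution σ such that A_{|o} ≡_{HA₂∪ℰ} σl and B ≡_{HA₂∪ℰ} A[σr]_o. -/

import Mathlib

set_option maxHeartbeats 1000000

attribute [local instance] Classical.propDecidable

namespace HAModulo

/-- The two sorts: `ι` for natural numbers, `κ` for classes. -/
inductive HSort : Type where
  | iota : HSort
  | kappa : HSort
deriving DecidableEq

mutual

/-- Terms of the language of `HA` (possibly extended by extra function symbols
`F` of sort `ι`, with arities `farity`), intrinsically sorted.  The Skolem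
(comprehension) symbols `f_{x,y₁,…,yₙ,A}` are represented by the constructor
`compr`. -/
inductive HTm (F : Type) (farity : F → ℕ) : HSort → Type where
  | var (x : ℕ) : HTm F farity .iota
  | cvar (X : ℕ) : HTm F farity .kappa
  | zero : HTm F farity .iota
  | succ (t : HTm F farity .iota) : HTm F farity .iota
  | add (t u : HTm F farity .iota) : HTm F farity .iota
  | mul (t u : HTm F farity .iota) : HTm F farity .iota
  | pred (t : HTm F farity .iota) : HTm F farity .iota
  | extra (g : F) (args : Fin (farity g) → HTm F farity .iota) : HTm F farity .iota
  | compr (x : ℕ) (ys : List ℕ) (A : HFm F farity)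
      (args : Fin ys.length → HTm F farity .iota) : HTm F farity .kappa

/-- Propositions of the language of `HA`. -/
inductive HFm (F : Type) (farity : F → ℕ) : Type where
  | eps (t : HTm F farity .iota) (c : HTm F farity .kappa) : HFm F farity
  | eq (t u : HTm F farity .iota) : HFm F farity
  | nat (t : HTm F farity .iota) : HFm F farity
  | null (t : HTm F farity .iota) : HFm F farity
  | top : HFm F farity
  | bot : HFm F farity
  | and (A B : HFm F farity) : HFm F farity
  | or (A B : HFm F farity) : HFm F farity
  | imp (A B : HFm F farity) : HFm F farity
  | all (x : ℕ) (A : HFm F farity) : HFm F farity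
  | ex (x : ℕ) (A : HFm F farity) : HFm F farity
  | allC (X : ℕ) (A : HFm F farity) : HFm F farity
  | exC (X : ℕ) (A : HFm F farity) : HFm F farity

end

variable {F : Type} {farity : F → ℕ}

/-- The identity substitution for `ι`-variables. -/
def idI : ℕ → HTm F farity .iota := fun y => .var y

/-- The identity substitution for `κ`-variables. -/
def idK : ℕ → HTm F farity .kappa := fun Y => .cvar Y

mutual

/-- Simultaneous substitution (of `ι`-terms for `ι`-variables and `κ`-terms for
`κ`-variables) in terms. -/
noncomputable def ssubT (σ : ℕ → HTm F farity .iota) (τ : ℕ → HTm F farity .kappa) :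
    {s : HSort} → HTm F farity s → HTm F farity s
  | _, .var x => σ x
  | _, .cvar X => τ X
  | _, .zero => .zero
  | _, .succ t => .succ (ssubT σ τ t)
  | _, .add t u => .add (ssubT σ τ t) (ssubT σ τ u)
  | _, .mul t u => .mul (ssubT σ τ t) (ssubT σ τ u)
  | _, .pred t => .pred (ssubT σ τ t)
  | _, .extra g args => .extra g (fun i => ssubT σ τ (args i))
  | _, .compr x ys A args =>
      .compr x ys (ssubF (fun z => if z = x ∨ z ∈ ys then .var z else σ z) τ A)
        (fun i => ssubT σ τ (args i))

/-- Simultaneous substitution in propositions. -/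
noncomputable def ssubF (σ : ℕ → HTm F farity .iota) (τ : ℕ → HTm F farity .kappa) :
    HFm F farity → HFm F farity
  | .eps t c => .eps (ssubT σ τ t) (ssubT σ τ c)
  | .eq t u => .eq (ssubT σ τ t) (ssubT σ τ u)
  | .nat t => .nat (ssubT σ τ t)
  | .null t => .null (ssubT σ τ t)
  | .top => .top
  | .bot => .bot
  | .and A B => .and (ssubF σ τ A) (ssubF σ τ B)
  | .or A B => .or (ssubF σ τ A) (ssubF σ τ B)
  | .imp A B => .imp (ssubF σ τ A) (ssubF σ τ B)
  | .all x A => .all x (ssubF (Function.update σ x (.var x)) τ A)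
  | .ex x A => .ex x (ssubF (Function.update σ x (.var x)) τ A)
  | .allC X A => .allC X (ssubF σ (Function.update τ X (.cvar X)) A)
  | .exC X A => .exC X (ssubF σ (Function.update τ X (.cvar X)) A)

end

/-- Substitution `(t/x)` of a single `ι`-term, in terms. -/
noncomputable def subIT (x : ℕ) (t : HTm F farity .iota) {s : HSort}
    (u : HTm F farity s) : HTm F farity s :=
  ssubT (Function.update idI x t) idK u

/-- Substitution `(c/X)` of a single `κ`-term, in terms. -/
noncomputable def subKT (X : ℕ) (c : HTm F farity .kappa) {s : HSort}
    (u : HTm F farity s) : HTm F farity s :=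
  ssubT idI (Function.update idK X c) u

/-- Substitution `(t/x)A` of a single `ι`-term, in propositions. -/
noncomputable def subIF (x : ℕ) (t : HTm F farity .iota) (A : HFm F farity) : HFm F farity :=
  ssubF (Function.update idI x t) idK A

/-- Substitution `(c/X)A` of a single `κ`-term, in propositions. -/
noncomputable def subKF (X : ℕ) (c : HTm F farity .kappa) (A : HFm F farity) : HFm F farity :=
  ssubF idI (Function.update idK X c) A

/-- Substitution of a single term of either sort, in terms. -/
noncomputable def subAnyT : (s : HSort) → ℕ → HTm F farity s →
    {s' : HSort} → HTm F farity s' → HTm F farity s'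
  | .iota, x, t => fun u => subIT x t u
  | .kappa, X, c => fun u => subKT X c u

mutual

/-- Free variables (with their sorts) of a term. -/
def hfvT : {s : HSort} → HTm F farity s → Set (HSort × ℕ)
  | _, .var x => {(HSort.iota, x)}
  | _, .cvar X => {(HSort.kappa, X)}
  | _, .zero => ∅
  | _, .succ t => hfvT t
  | _, .add t u => hfvT t ∪ hfvT u
  | _, .mul t u => hfvT t ∪ hfvT u
  | _, .pred t => hfvT t
  | _, .extra _ args => ⋃ i, hfvT (args i)
  | _, .compr x ys A args =>
      (hfvF A \ {p | p.1 = HSort.iota ∧ (p.2 = x ∨ p.2 ∈ ys)}) ∪ ⋃ i, hfvT (args i)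

/-- Free variables (with their sorts) of a proposition. -/
def hfvF : HFm F farity → Set (HSort × ℕ)
  | .eps t c => hfvT t ∪ hfvT c
  | .eq t u => hfvT t ∪ hfvT u
  | .nat t => hfvT t
  | .null t => hfvT t
  | .top => ∅
  | .bot => ∅
  | .and A B => hfvF A ∪ hfvF B
  | .or A B => hfvF A ∪ hfvF B
  | .imp A B => hfvF A ∪ hfvF B
  | .all x A => hfvF A \ {(HSort.iota, x)}
  | .ex x A => hfvF A \ {(HSort.iota, x)}
  | .allC X A => hfvF A \ {(HSort.kappa, X)}
  | .exC X A => hfvF A \ {(HSort.kappa, X)}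

end

/-- Proof-terms. -/
inductive HPf (F : Type) (farity : F → ℕ) : Type where
  | pvar (α : ℕ) : HPf F farity
  | triv : HPf F farity
  | botElim (π : HPf F farity) : HPf F farity
  | pair (π₁ π₂ : HPf F farity) : HPf F farity
  | fst (π : HPf F farity) : HPf F farity
  | snd (π : HPf F farity) : HPf F farity
  | inl (π : HPf F farity) : HPf F farity
  | inr (π : HPf F farity) : HPf F farity
  | case (π₁ : HPf F farity) (α : ℕ) (π₂ : HPf F farity) (β : ℕ) (π₃ : HPf F farity) :
      HPf F farity
  | lam (α : ℕ) (π : HPf F farity) : HPf F farity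
  | app (π₁ π₂ : HPf F farity) : HPf F farity
  | tlam (x : ℕ) (s : HSort) (π : HPf F farity) : HPf F farity
  | tapp (π : HPf F farity) (s : HSort) (t : HTm F farity s) : HPf F farity
  | wit (s : HSort) (t : HTm F farity s) (π : HPf F farity) : HPf F farity
  | exElim (π₁ : HPf F farity) (x : ℕ) (s : HSort) (α : ℕ) (π₂ : HPf F farity) : HPf F farity

/-- Substitution `(ρ/α)π` of a proof-term for a proof variable. -/
noncomputable def HPf.psub : HPf F farity → ℕ → HPf F farity → HPf F farity
  | .pvar β, α, ρ => if β = α then ρ else .pvar β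
  | .triv, _, _ => .triv
  | .botElim π, α, ρ => .botElim (π.psub α ρ)
  | .pair π₁ π₂, α, ρ => .pair (π₁.psub α ρ) (π₂.psub α ρ)
  | .fst π, α, ρ => .fst (π.psub α ρ)
  | .snd π, α, ρ => .snd (π.psub α ρ)
  | .inl π, α, ρ => .inl (π.psub α ρ)
  | .inr π, α, ρ => .inr (π.psub α ρ)
  | .case π₁ β π₂ γ π₃, α, ρ =>
      .case (π₁.psub α ρ) β (if β = α then π₂ else π₂.psub α ρ) γ
        (if γ = α then π₃ else π₃.psub α ρ)
  | .lam β π, α, ρ => .lam β (if β = α then π else π.psub α ρ)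
  | .app π₁ π₂, α, ρ => .app (π₁.psub α ρ) (π₂.psub α ρ)
  | .tlam x s π, α, ρ => .tlam x s (π.psub α ρ)
  | .tapp π s t, α, ρ => .tapp (π.psub α ρ) s t
  | .wit s t π, α, ρ => .wit s t (π.psub α ρ)
  | .exElim π₁ x s β π₂, α, ρ =>
      .exElim (π₁.psub α ρ) x s β (if β = α then π₂ else π₂.psub α ρ)

/-- Substitution `(t/x)π` of a term for a term variable in a proof-term. -/
noncomputable def HPf.tsub : HPf F farity → ℕ → (s : HSort) → HTm F farity s → HPf F farity
  | .pvar β, _, _, _ => .pvar β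
  | .triv, _, _, _ => .triv
  | .botElim π, x, s, t => .botElim (π.tsub x s t)
  | .pair π₁ π₂, x, s, t => .pair (π₁.tsub x s t) (π₂.tsub x s t)
  | .fst π, x, s, t => .fst (π.tsub x s t)
  | .snd π, x, s, t => .snd (π.tsub x s t)
  | .inl π, x, s, t => .inl (π.tsub x s t)
  | .inr π, x, s, t => .inr (π.tsub x s t)
  | .case π₁ β π₂ γ π₃, x, s, t =>
      .case (π₁.tsub x s t) β (π₂.tsub x s t) γ (π₃.tsub x s t)
  | .lam β π, x, s, t => .lam β (π.tsub x s t)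
  | .app π₁ π₂, x, s, t => .app (π₁.tsub x s t) (π₂.tsub x s t)
  | .tlam y s' π, x, s, t => .tlam y s' (if s' = s ∧ y = x then π else π.tsub x s t)
  | .tapp π s' u, x, s, t => .tapp (π.tsub x s t) s' (subAnyT s x t u)
  | .wit s' u π, x, s, t => .wit s' (subAnyT s x t u) (π.tsub x s t)
  | .exElim π₁ y s' β π₂, x, s, t =>
      .exElim (π₁.tsub x s t) y s' β (if s' = s ∧ y = x then π₂ else π₂.tsub x s t)

/-- The cut-elimination reduction `▷` on proof-terms (one step, at any position). -/
inductive HRed : HPf F farity → HPf F farity → Prop where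
  | fstPair (π₁ π₂ : HPf F farity) : HRed (.fst (.pair π₁ π₂)) π₁
  | sndPair (π₁ π₂ : HPf F farity) : HRed (.snd (.pair π₁ π₂)) π₂
  | caseInl (π₁ : HPf F farity) (α : ℕ) (π₂ : HPf F farity) (β : ℕ) (π₃ : HPf F farity) :
      HRed (.case (.inl π₁) α π₂ β π₃) (π₂.psub α π₁)
  | caseInr (π₁ : HPf F farity) (α : ℕ) (π₂ : HPf F farity) (β : ℕ) (π₃ : HPf F farity) :
      HRed (.case (.inr π₁) α π₂ β π₃) (π₃.psub β π₁)
  | beta (α : ℕ) (π₁ π₂ : HPf F farity) : HRed (.app (.lam α π₁) π₂) (π₁.psub α π₂)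
  | tbeta (x : ℕ) (s : HSort) (π : HPf F farity) (t : HTm F farity s) :
      HRed (.tapp (.tlam x s π) s t) (π.tsub x s t)
  | exBeta (s : HSort) (t : HTm F farity s) (π₁ : HPf F farity) (x α : ℕ) (π₂ : HPf F farity) :
      HRed (.exElim (.wit s t π₁) x s α π₂) ((π₂.tsub x s t).psub α π₁)
  | botElimC {π π' : HPf F farity} : HRed π π' → HRed (.botElim π) (.botElim π')
  | pairC₁ {π₁ π₁' : HPf F farity} (π₂ : HPf F farity) :
      HRed π₁ π₁' → HRed (.pair π₁ π₂) (.pair π₁' π₂)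
  | pairC₂ (π₁ : HPf F farity) {π₂ π₂' : HPf F farity} :
      HRed π₂ π₂' → HRed (.pair π₁ π₂) (.pair π₁ π₂')
  | fstC {π π' : HPf F farity} : HRed π π' → HRed (.fst π) (.fst π')
  | sndC {π π' : HPf F farity} : HRed π π' → HRed (.snd π) (.snd π')
  | inlC {π π' : HPf F farity} : HRed π π' → HRed (.inl π) (.inl π')
  | inrC {π π' : HPf F farity} : HRed π π' → HRed (.inr π) (.inr π')
  | caseC₁ {π₁ π₁' : HPf F farity} (α : ℕ) (π₂ : HPf F farity) (β : ℕ) (π₃ : HPf F farity) :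
      HRed π₁ π₁' → HRed (.case π₁ α π₂ β π₃) (.case π₁' α π₂ β π₃)
  | caseC₂ (π₁ : HPf F farity) (α : ℕ) {π₂ π₂' : HPf F farity} (β : ℕ) (π₃ : HPf F farity) :
      HRed π₂ π₂' → HRed (.case π₁ α π₂ β π₃) (.case π₁ α π₂' β π₃)
  | caseC₃ (π₁ : HPf F farity) (α : ℕ) (π₂ : HPf F farity) (β : ℕ) {π₃ π₃' : HPf F farity} :
      HRed π₃ π₃' → HRed (.case π₁ α π₂ β π₃) (.case π₁ α π₂ β π₃')
  | lamC (α : ℕ) {π π' : HPf F farity} : HRed π π' → HRed (.lam α π) (.lam α π')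
  | appC₁ {π₁ π₁' : HPf F farity} (π₂ : HPf F farity) :
      HRed π₁ π₁' → HRed (.app π₁ π₂) (.app π₁' π₂)
  | appC₂ (π₁ : HPf F farity) {π₂ π₂' : HPf F farity} :
      HRed π₂ π₂' → HRed (.app π₁ π₂) (.app π₁ π₂')
  | tlamC (x : ℕ) (s : HSort) {π π' : HPf F farity} :
      HRed π π' → HRed (.tlam x s π) (.tlam x s π')
  | tappC {π π' : HPf F farity} (s : HSort) (t : HTm F farity s) :
      HRed π π' → HRed (.tapp π s t) (.tapp π' s t)
  | witC (s : HSort) (t : HTm F farity s) {π π' : HPf F farity} :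
      HRed π π' → HRed (.wit s t π) (.wit s t π')
  | exElimC₁ {π₁ π₁' : HPf F farity} (x : ℕ) (s : HSort) (α : ℕ) (π₂ : HPf F farity) :
      HRed π₁ π₁' → HRed (.exElim π₁ x s α π₂) (.exElim π₁' x s α π₂)
  | exElimC₂ (π₁ : HPf F farity) (x : ℕ) (s : HSort) (α : ℕ) {π₂ π₂' : HPf F farity} :
      HRed π₂ π₂' → HRed (.exElim π₁ x s α π₂) (.exElim π₁ x s α π₂')

/-- `π ▷* π'`. -/
def HRedStar : HPf F farity → HPf F farity → Prop := Relation.ReflTransGen HRed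

/-- Strongly normalizing proof-terms: the reduction tree is finite. -/
def HSN (π : HPf F farity) : Prop := Acc (fun a b : HPf F farity => HRed b a) π

/-- The set of strongly normalizing proof-terms. -/
def HSNset (F : Type) (farity : F → ℕ) : Set (HPf F farity) := {π | HSN π}

/-- A proof-term is normal if it admits no reduction. -/
def HNormal (π : HPf F farity) : Prop := ∀ π', ¬ HRed π π'

/-- Neutral proof-terms: axioms and eliminations. -/
def HNeutral : HPf F farity → Prop := fun π =>
  match π with
  | .pvar _ => True
  | .botElim _ => True
  | .fst _ => True
  | .snd _ => True
  | .case _ _ _ _ _ => True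
  | .app _ _ => True
  | .tapp _ _ _ => True
  | .exElim _ _ _ _ _ => True
  | _ => False

/-- Free proof variables of a proof-term. -/
def HPf.pfv : HPf F farity → Set ℕ
  | .pvar α => {α}
  | .triv => ∅
  | .botElim π => π.pfv
  | .pair π₁ π₂ => π₁.pfv ∪ π₂.pfv
  | .fst π => π.pfv
  | .snd π => π.pfv
  | .inl π => π.pfv
  | .inr π => π.pfv
  | .case π₁ α π₂ β π₃ => π₁.pfv ∪ (π₂.pfv \ {α}) ∪ (π₃.pfv \ {β})
  | .lam α π => π.pfv \ {α}
  | .app π₁ π₂ => π₁.pfv ∪ π₂.pfv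
  | .tlam _ _ π => π.pfv
  | .tapp π _ _ => π.pfv
  | .wit _ _ π => π.pfv
  | .exElim π₁ _ _ α π₂ => π₁.pfv ∪ (π₂.pfv \ {α})

/-- Free term variables of a proof-term. -/
def HPf.tfv : HPf F farity → Set (HSort × ℕ)
  | .pvar _ => ∅
  | .triv => ∅
  | .botElim π => π.tfv
  | .pair π₁ π₂ => π₁.tfv ∪ π₂.tfv
  | .fst π => π.tfv
  | .snd π => π.tfv
  | .inl π => π.tfv
  | .inr π => π.tfv
  | .case π₁ _ π₂ _ π₃ => π₁.tfv ∪ π₂.tfv ∪ π₃.tfv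
  | .lam _ π => π.tfv
  | .app π₁ π₂ => π₁.tfv ∪ π₂.tfv
  | .tlam x s π => π.tfv \ {(s, x)}
  | .tapp π _ t => π.tfv ∪ hfvT t
  | .wit _ t π => hfvT t ∪ π.tfv
  | .exElim π₁ x s _ π₂ => π₁.tfv ∪ (π₂.tfv \ {(s, x)})

/-- Closed proof-terms. -/
def HClosed (π : HPf F farity) : Prop := π.pfv = ∅ ∧ π.tfv = ∅

/-- Reducibility candidates. -/
def isCandH (R : Set (HPf F farity)) : Prop :=
  (∀ π ∈ R, HSN π) ∧
  (∀ π ∈ R, ∀ π', HRedStar π π' → π' ∈ R) ∧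
  (∀ π : HPf F farity, HNeutral π → (∀ π', HRed π π' → π' ∈ R) → π ∈ R)

/-- The operation `∧̃` on candidates. -/
def cAndH (A B : Set (HPf F farity)) : Set (HPf F farity) :=
  {π | HSN π ∧ ∀ π₁ π₂, HRedStar π (.pair π₁ π₂) → π₁ ∈ A ∧ π₂ ∈ B}

/-- The operation `∨̃` on candidates. -/
def cOrH (A B : Set (HPf F farity)) : Set (HPf F farity) :=
  {π | HSN π ∧ (∀ π₁, HRedStar π (.inl π₁) → π₁ ∈ A) ∧ (∀ π₂, HRedStar π (.inr π₂) → π₂ ∈ B)}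

/-- The operation `⇒̃` on candidates. -/
def cImpH (A B : Set (HPf F farity)) : Set (HPf F farity) :=
  {π | HSN π ∧ ∀ (α : ℕ) (π' : HPf F farity), HRedStar π (.lam α π') → ∀ σ ∈ A, π'.psub α σ ∈ B}

/-- The operation `∀̃` on sets of candidates. -/
def cAllH (𝒜 : Set (Set (HPf F farity))) : Set (HPf F farity) :=
  {π | HSN π ∧ ∀ (x : ℕ) (s : HSort) (π' : HPf F farity), HRedStar π (.tlam x s π') →
      ∀ X ∈ 𝒜, ∀ t : HTm F farity s, π'.tsub x s t ∈ X}

/-- The operation `∃̃` on sets of candidates. -/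
def cExH (𝒜 : Set (Set (HPf F farity))) : Set (HPf F farity) :=
  {π | HSN π ∧ ∀ (s : HSort) (t : HTm F farity s) (π' : HPf F farity),
      HRedStar π (.wit s t π') → ∃ X ∈ 𝒜, π' ∈ X}

/-- A set of equational axioms (à la Herbrand–Gödel) between terms of sort `ι`:
each pair is an equation, universally quantified over its free variables. -/
abbrev ESet (F : Type) (farity : F → ℕ) : Type :=
  Set (HTm F farity .iota × HTm F farity .iota)

/-- The congruence on terms defined by the term rewrite rules `HA₂`
(`Pred`, `+`, `×`) together with the equations of `ℰ`.  For `ℰ = ∅` this is the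
congruence `≡_HA` on terms. -/
inductive TEq (E : ESet F farity) : {s : HSort} → HTm F farity s → HTm F farity s → Prop where
  | predZero : TEq E (.pred .zero) .zero
  | predSucc (t : HTm F farity .iota) : TEq E (.pred (.succ t)) t
  | addZero (u : HTm F farity .iota) : TEq E (.add .zero u) u
  | addSucc (t u : HTm F farity .iota) : TEq E (.add (.succ t) u) (.succ (.add t u))
  | mulZero (u : HTm F farity .iota) : TEq E (.mul .zero u) .zero
  | mulSucc (t u : HTm F farity .iota) : TEq E (.mul (.succ t) u) (.add (.mul t u) u)
  | axm {l r : HTm F farity .iota} (σ : ℕ → HTm F farity .iota) :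
      (l, r) ∈ E → TEq E (ssubT σ idK l) (ssubT σ idK r)
  | refl {s : HSort} (t : HTm F farity s) : TEq E t t
  | symm {s : HSort} {t u : HTm F farity s} : TEq E t u → TEq E u t
  | trans {s : HSort} {t u v : HTm F farity s} : TEq E t u → TEq E u v → TEq E t v
  | succC {t t' : HTm F farity .iota} : TEq E t t' → TEq E (.succ t) (.succ t')
  | addC {t t' u u' : HTm F farity .iota} :
      TEq E t t' → TEq E u u' → TEq E (.add t u) (.add t' u')
  | mulC {t t' u u' : HTm F farity .iota} :
      TEq E t t' → TEq E u u' → TEq E (.mul t u) (.mul t' u')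
  | predC {t t' : HTm F farity .iota} : TEq E t t' → TEq E (.pred t) (.pred t')
  | extraC (g : F) {args args' : Fin (farity g) → HTm F farity .iota} :
      (∀ i, TEq E (args i) (args' i)) → TEq E (.extra g args) (.extra g args')
  | comprC (x : ℕ) (ys : List ℕ) (A : HFm F farity)
      {args args' : Fin ys.length → HTm F farity .iota} :
      (∀ i, TEq E (args i) (args' i)) → TEq E (.compr x ys A args) (.compr x ys A args')

/-- The substitution `[x ↦ t, yᵢ ↦ args i]` used in the instances of the
comprehension rewrite rule. -/
noncomputable def comprSub (t : HTm F farity .iota) (x : ℕ) (ys : List ℕ)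
    (args : Fin ys.length → HTm F farity .iota) : ℕ → HTm F farity .iota :=
  fun z =>
    if z = x then t
    else if h : z ∈ ys then args ⟨ys.idxOf z, List.idxOf_lt_length_iff.mpr h⟩
    else .var z

/-- The instances of the five proposition rewrite rules of `HA₁`:
comprehension, `=`, `N`, `Null(0)` and `Null(S(x))`. -/
inductive HA1Inst : HFm F farity → HFm F farity → Prop where
  | comprR (t : HTm F farity .iota) (x : ℕ) (ys : List ℕ) (A : HFm F farity)
      (args : Fin ys.length → HTm F farity .iota) :
      HA1Inst (.eps t (.compr x ys A args)) (ssubF (comprSub t x ys args) idK A)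
  | eqR (t u : HTm F farity .iota) (X : ℕ) :
      HA1Inst (.eq t u) (.allC X (.imp (.eps t (.cvar X)) (.eps u (.cvar X))))
  | natR (t : HTm F farity .iota) (X y : ℕ) (hy : (HSort.iota, y) ∉ hfvT t) :
      HA1Inst (.nat t)
        (.allC X (.imp (.eps .zero (.cvar X))
          (.imp (.all y (.imp (.nat (.var y))
              (.imp (.eps (.var y) (.cvar X)) (.eps (.succ (.var y)) (.cvar X)))))
            (.eps t (.cvar X)))))
  | nullZ : HA1Inst (.null .zero) .top
  | nullS (t : HTm F farity .iota) : HA1Inst (.null (.succ t)) .bot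

/-- The congruence `≡_{HA₂∪ℰ}` on propositions: the congruence generated on
propositions by the term rewrite rules of `HA₂` and the equations of `ℰ`
(no proposition rewrite rule). -/
inductive FEq2 (E : ESet F farity) : HFm F farity → HFm F farity → Prop where
  | epsC {t t' : HTm F farity .iota} {c c' : HTm F farity .kappa} :
      TEq E t t' → TEq E c c' → FEq2 E (.eps t c) (.eps t' c')
  | eqC {t t' u u' : HTm F farity .iota} :
      TEq E t t' → TEq E u u' → FEq2 E (.eq t u) (.eq t' u')
  | natC {t t' : HTm F farity .iota} : TEq E t t' → FEq2 E (.nat t) (.nat t')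
  | nullC {t t' : HTm F farity .iota} : TEq E t t' → FEq2 E (.null t) (.null t')
  | refl (A : HFm F farity) : FEq2 E A A
  | symm {A B : HFm F farity} : FEq2 E A B → FEq2 E B A
  | trans {A B C : HFm F farity} : FEq2 E A B → FEq2 E B C → FEq2 E A C
  | andC {A A' B B' : HFm F farity} :
      FEq2 E A A' → FEq2 E B B' → FEq2 E (.and A B) (.and A' B')
  | orC {A A' B B' : HFm F farity} :
      FEq2 E A A' → FEq2 E B B' → FEq2 E (.or A B) (.or A' B')
  | impC {A A' B B' : HFm F farity} :
      FEq2 E A A' → FEq2 E B B' → FEq2 E (.imp A B) (.imp A' B')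
  | allC' (x : ℕ) {A A' : HFm F farity} : FEq2 E A A' → FEq2 E (.all x A) (.all x A')
  | exC' (x : ℕ) {A A' : HFm F farity} : FEq2 E A A' → FEq2 E (.ex x A) (.ex x A')
  | allCC (X : ℕ) {A A' : HFm F farity} : FEq2 E A A' → FEq2 E (.allC X A) (.allC X A')
  | exCC (X : ℕ) {A A' : HFm F farity} : FEq2 E A A' → FEq2 E (.exC X A) (.exC X A')

/-- The congruence `≡_{HA∪ℰ}` on propositions, defined by all the rewrite rules
of `HA` together with the equations of `ℰ`.  For `ℰ = ∅` this is `≡_HA`. -/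
inductive FEq (E : ESet F farity) : HFm F farity → HFm F farity → Prop where
  | ha1 {A B : HFm F farity} : HA1Inst A B → FEq E A B
  | epsC {t t' : HTm F farity .iota} {c c' : HTm F farity .kappa} :
      TEq E t t' → TEq E c c' → FEq E (.eps t c) (.eps t' c')
  | eqC {t t' u u' : HTm F farity .iota} :
      TEq E t t' → TEq E u u' → FEq E (.eq t u) (.eq t' u')
  | natC {t t' : HTm F farity .iota} : TEq E t t' → FEq E (.nat t) (.nat t')
  | nullC {t t' : HTm F farity .iota} : TEq E t t' → FEq E (.null t) (.null t')
  | refl (A : HFm F farity) : FEq E A A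
  | symm {A B : HFm F farity} : FEq E A B → FEq E B A
  | trans {A B C : HFm F farity} : FEq E A B → FEq E B C → FEq E A C
  | andC {A A' B B' : HFm F farity} :
      FEq E A A' → FEq E B B' → FEq E (.and A B) (.and A' B')
  | orC {A A' B B' : HFm F farity} :
      FEq E A A' → FEq E B B' → FEq E (.or A B) (.or A' B')
  | impC {A A' B B' : HFm F farity} :
      FEq E A A' → FEq E B B' → FEq E (.imp A B) (.imp A' B')
  | allC' (x : ℕ) {A A' : HFm F farity} : FEq E A A' → FEq E (.all x A) (.all x A')
  | exC' (x : ℕ) {A A' : HFm F farity} : FEq E A A' → FEq E (.ex x A) (.ex x A')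
  | allCC (X : ℕ) {A A' : HFm F farity} : FEq E A A' → FEq E (.allC X A) (.allC X A')
  | exCC (X : ℕ) {A A' : HFm F farity} : FEq E A A' → FEq E (.exC X A) (.exC X A')

/-- Contexts: named hypotheses. -/
abbrev HCtx (F : Type) (farity : F → ℕ) : Type := List (ℕ × HFm F farity)

def hctxFv (Γ : HCtx F farity) : Set (HSort × ℕ) := {p | ∃ q ∈ Γ, p ∈ hfvF q.2}

/-- Intuitionistic natural deduction modulo the congruence `≡_{HA∪ℰ}`,
presented on proof-terms.  For `E = ∅` this is deduction modulo `≡_HA`. -/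
inductive HND (E : ESet F farity) : HCtx F farity → HPf F farity → HFm F farity → Prop where
  | ax {Γ : HCtx F farity} {α : ℕ} {A B : HFm F farity} :
      (α, A) ∈ Γ → FEq E A B → HND E Γ (.pvar α) B
  | topI {Γ : HCtx F farity} {A : HFm F farity} : FEq E A .top → HND E Γ .triv A
  | botE {Γ : HCtx F farity} {π : HPf F farity} {A B : HFm F farity} :
      HND E Γ π B → FEq E B .bot → HND E Γ (.botElim π) A
  | andI {Γ : HCtx F farity} {π₁ π₂ : HPf F farity} {A B C : HFm F farity} :
      HND E Γ π₁ A → HND E Γ π₂ B → FEq E C (.and A B) → HND E Γ (.pair π₁ π₂) C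
  | andE₁ {Γ : HCtx F farity} {π : HPf F farity} {A B C : HFm F farity} :
      HND E Γ π C → FEq E C (.and A B) → HND E Γ (.fst π) A
  | andE₂ {Γ : HCtx F farity} {π : HPf F farity} {A B C : HFm F farity} :
      HND E Γ π C → FEq E C (.and A B) → HND E Γ (.snd π) B
  | orI₁ {Γ : HCtx F farity} {π : HPf F farity} {A B C : HFm F farity} :
      HND E Γ π A → FEq E C (.or A B) → HND E Γ (.inl π) C
  | orI₂ {Γ : HCtx F farity} {π : HPf F farity} {A B C : HFm F farity} :
      HND E Γ π B → FEq E C (.or A B) → HND E Γ (.inr π) C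
  | orE {Γ : HCtx F farity} {π₁ π₂ π₃ : HPf F farity} {α β : ℕ} {A B C D : HFm F farity} :
      HND E Γ π₁ D → FEq E D (.or A B) → HND E ((α, A) :: Γ) π₂ C →
      HND E ((β, B) :: Γ) π₃ C → HND E Γ (.case π₁ α π₂ β π₃) C
  | impI {Γ : HCtx F farity} {π : HPf F farity} {α : ℕ} {A B C : HFm F farity} :
      HND E ((α, A) :: Γ) π B → FEq E C (.imp A B) → HND E Γ (.lam α π) C
  | impE {Γ : HCtx F farity} {π₁ π₂ : HPf F farity} {A B C : HFm F farity} :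
      HND E Γ π₁ C → FEq E C (.imp A B) → HND E Γ π₂ A → HND E Γ (.app π₁ π₂) B
  | allI {Γ : HCtx F farity} {π : HPf F farity} {x : ℕ} {A B : HFm F farity} :
      HND E Γ π A → FEq E B (.all x A) → (HSort.iota, x) ∉ hctxFv Γ →
      HND E Γ (.tlam x .iota π) B
  | allE {Γ : HCtx F farity} {π : HPf F farity} {x : ℕ} {t : HTm F farity .iota}
      {A B C : HFm F farity} :
      HND E Γ π B → FEq E B (.all x A) → FEq E C (subIF x t A) → HND E Γ (.tapp π .iota t) C
  | exI {Γ : HCtx F farity} {π : HPf F farity} {x : ℕ} {t : HTm F farity .iota}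
      {A B C : HFm F farity} :
      HND E Γ π C → FEq E B (.ex x A) → FEq E C (subIF x t A) → HND E Γ (.wit .iota t π) B
  | exE {Γ : HCtx F farity} {π₁ π₂ : HPf F farity} {x α : ℕ} {A B C : HFm F farity} :
      HND E Γ π₁ C → FEq E C (.ex x A) → HND E ((α, A) :: Γ) π₂ B →
      (HSort.iota, x) ∉ hctxFv Γ ∪ hfvF B → HND E Γ (.exElim π₁ x .iota α π₂) B
  | allCI {Γ : HCtx F farity} {π : HPf F farity} {X : ℕ} {A B : HFm F farity} :
      HND E Γ π A → FEq E B (.allC X A) → (HSort.kappa, X) ∉ hctxFv Γ →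
      HND E Γ (.tlam X .kappa π) B
  | allCE {Γ : HCtx F farity} {π : HPf F farity} {X : ℕ} {c : HTm F farity .kappa}
      {A B C : HFm F farity} :
      HND E Γ π B → FEq E B (.allC X A) → FEq E C (subKF X c A) → HND E Γ (.tapp π .kappa c) C
  | exCI {Γ : HCtx F farity} {π : HPf F farity} {X : ℕ} {c : HTm F farity .kappa}
      {A B C : HFm F farity} :
      HND E Γ π C → FEq E B (.exC X A) → FEq E C (subKF X c A) → HND E Γ (.wit .kappa c π) B
  | exCE {Γ : HCtx F farity} {π₁ π₂ : HPf F farity} {X α : ℕ} {A B C : HFm F farity} :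
      HND E Γ π₁ C → FEq E C (.exC X A) → HND E ((α, A) :: Γ) π₂ B →
      (HSort.kappa, X) ∉ hctxFv Γ ∪ hfvF B → HND E Γ (.exElim π₁ X .kappa α π₂) B

/-- The term `n̲ = Sⁿ(0)`. -/
def numeral : ℕ → HTm F farity .iota
  | 0 => .zero
  | n + 1 => .succ (numeral n)

/-- The Parigot numeral `ρₙ`, a proof of `N(n̲)`:
`ρ₀ = λX λα λβ α` and `ρ_{n+1} = λX λα λβ (β n̲ ρₙ (ρₙ X α β))`. -/
def rho : ℕ → HPf F farity
  | 0 => .tlam 0 .kappa (.lam 0 (.lam 1 (.pvar 0)))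
  | n + 1 =>
      .tlam 0 .kappa (.lam 0 (.lam 1
        (.app (.app (.tapp (.pvar 1) .iota (numeral n)) (rho n))
          (.app (.app (.tapp (rho n) .kappa (.cvar 0)) (.pvar 0)) (.pvar 1)))))

/-- The application `(π p̲₁ ρ_{p₁} ⋯ p̲ₙ ρ_{pₙ})`. -/
def apps (π : HPf F farity) (ps : List ℕ) : HPf F farity :=
  ps.foldl (fun acc p => .app (.tapp acc .iota (numeral p)) (rho p)) π

/-- The proposition `∀x₁ (N(x₁) ⇒ ∀x₂ (N(x₂) ⇒ … ⇒ ∀xₙ (N(xₙ) ⇒ core)…))`,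
where `xᵢ` is the variable `i`. -/
def specFm (n : ℕ) (core : HFm F farity) : HFm F farity :=
  (List.range n).foldr (fun i A => .all (i + 1) (.imp (.nat (.var (i + 1))) A)) core

/-- One-step rewriting by the proposition rules of `HA₁`, at any occurrence
of an atomic proposition. -/
inductive Step1 : HFm F farity → HFm F farity → Prop where
  | root {A B : HFm F farity} : HA1Inst A B → Step1 A B
  | and₁ {A A' : HFm F farity} (B : HFm F farity) : Step1 A A' → Step1 (.and A B) (.and A' B)
  | and₂ (A : HFm F farity) {B B' : HFm F farity} : Step1 B B' → Step1 (.and A B) (.and A B')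
  | or₁ {A A' : HFm F farity} (B : HFm F farity) : Step1 A A' → Step1 (.or A B) (.or A' B)
  | or₂ (A : HFm F farity) {B B' : HFm F farity} : Step1 B B' → Step1 (.or A B) (.or A B')
  | imp₁ {A A' : HFm F farity} (B : HFm F farity) : Step1 A A' → Step1 (.imp A B) (.imp A' B)
  | imp₂ (A : HFm F farity) {B B' : HFm F farity} : Step1 B B' → Step1 (.imp A B) (.imp A B')
  | all (x : ℕ) {A A' : HFm F farity} : Step1 A A' → Step1 (.all x A) (.all x A')
  | ex (x : ℕ) {A A' : HFm F farity} : Step1 A A' → Step1 (.ex x A) (.ex x A')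
  | allC (X : ℕ) {A A' : HFm F farity} : Step1 A A' → Step1 (.allC X A) (.allC X A')
  | exC (X : ℕ) {A A' : HFm F farity} : Step1 A A' → Step1 (.exC X A) (.exC X A')

/-- The rewriting relation `→_{HA₁/HA₂∪ℰ}`: rewriting by the rules of `HA₁`
modulo `≡_{HA₂∪ℰ}`. -/
def RelMod (E : ESet F farity) (A B : HFm F farity) : Prop :=
  ∃ A' B', FEq2 E A A' ∧ Step1 A' B' ∧ FEq2 E B' B

/-- Occurrences in a proposition tree. -/
inductive Occ : Type where
  | here : Occ
  | and1 (o : Occ) : Occ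
  | and2 (o : Occ) : Occ
  | or1 (o : Occ) : Occ
  | or2 (o : Occ) : Occ
  | imp1 (o : Occ) : Occ
  | imp2 (o : Occ) : Occ
  | all (o : Occ) : Occ
  | ex (o : Occ) : Occ
  | allC (o : Occ) : Occ
  | exC (o : Occ) : Occ

/-- `A_{|o}`: the subtree of `A` at occurrence `o`. -/
def subAt : HFm F farity → Occ → Option (HFm F farity)
  | A, .here => some A
  | .and A _, .and1 o => subAt A o
  | .and _ B, .and2 o => subAt B o
  | .or A _, .or1 o => subAt A o
  | .or _ B, .or2 o => subAt B o
  | .imp A _, .imp1 o => subAt A o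
  | .imp _ B, .imp2 o => subAt B o
  | .all _ A, .all o => subAt A o
  | .ex _ A, .ex o => subAt A o
  | .allC _ A, .allC o => subAt A o
  | .exC _ A, .exC o => subAt A o
  | _, _ => none

/-- `A[C]_o`: the tree `A` where `C` has been grafted at occurrence `o`. -/
def graft : HFm F farity → Occ → HFm F farity → Option (HFm F farity)
  | _, .here, C => some C
  | .and A B, .and1 o, C => (graft A o C).map fun A' => .and A' B
  | .and A B, .and2 o, C => (graft B o C).map fun B' => .and A B'
  | .or A B, .or1 o, C => (graft A o C).map fun A' => .or A' B
  | .or A B, .or2 o, C => (graft B o C).map fun B' => .or A B'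
  | .imp A B, .imp1 o, C => (graft A o C).map fun A' => .imp A' B
  | .imp A B, .imp2 o, C => (graft B o C).map fun B' => .imp A B'
  | .all x A, .all o, C => (graft A o C).map fun A' => .all x A'
  | .ex x A, .ex o, C => (graft A o C).map fun A' => .ex x A'
  | .allC X A, .allC o, C => (graft A o C).map fun A' => .allC X A'
  | .exC X A, .exC o, C => (graft A o C).map fun A' => .exC X A'
  | _, _, _ => none

/-- Atomic propositions. -/
def isAtomH : HFm F farity → Prop := fun A =>
  match A with
  | .eps _ _ => True
  | .eq _ _ => True
  | .nat _ => True
  | .null _ => True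
  | _ => False

/-- Confluence of a relation. -/
def Confluent {α : Type*} (r : α → α → Prop) : Prop :=
  ∀ a b c : α, Relation.ReflTransGen r a b → Relation.ReflTransGen r a c →
    ∃ d, Relation.ReflTransGen r b d ∧ Relation.ReflTransGen r c d

/-- A relation on propositions is non-confusing. -/
def HNonConfusing (Req : HFm F farity → HFm F farity → Prop) : Prop :=
  ∀ A B : HFm F farity, Req A B → ¬ isAtomH A → ¬ isAtomH B →
    (A = .top ∧ B = .top) ∨
    (A = .bot ∧ B = .bot) ∨
    (∃ A₁ A₂ B₁ B₂, A = .and A₁ A₂ ∧ B = .and B₁ B₂ ∧ Req A₁ B₁ ∧ Req A₂ B₂) ∨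
    (∃ A₁ A₂ B₁ B₂, A = .or A₁ A₂ ∧ B = .or B₁ B₂ ∧ Req A₁ B₁ ∧ Req A₂ B₂) ∨
    (∃ A₁ A₂ B₁ B₂, A = .imp A₁ A₂ ∧ B = .imp B₁ B₂ ∧ Req A₁ B₁ ∧ Req A₂ B₂) ∨
    (∃ x A₁ B₁, A = .all x A₁ ∧ B = .all x B₁ ∧ Req A₁ B₁) ∨
    (∃ x A₁ B₁, A = .ex x A₁ ∧ B = .ex x B₁ ∧ Req A₁ B₁) ∨
    (∃ X A₁ B₁, A = .allC X A₁ ∧ B = .allC X B₁ ∧ Req A₁ B₁) ∨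
    (∃ X A₁ B₁, A = .exC X A₁ ∧ B = .exC X B₁ ∧ Req A₁ B₁)

/-- A `C`-model of the language of `HA` (possibly extended by the symbols of
`F`): domains for the two sorts, functions interpreting the function symbols
(including the Skolem comprehension symbols), and functions interpreting the
predicate symbols, valued in the algebra of reducibility candidates. -/
structure HModel (F : Type) (farity : F → ℕ) where
  Mi : Type
  Mk : Type
  Mi_ne : Nonempty Mi
  Mk_ne : Nonempty Mk
  zeroI : Mi
  succI : Mi → Mi
  addI : Mi → Mi → Mi
  mulI : Mi → Mi → Mi
  predI : Mi → Mi
  extraI : (g : F) → (Fin (farity g) → Mi) → Mi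
  comprI : (x : ℕ) → (ys : List ℕ) → HFm F farity → (Fin ys.length → Mi) → Mk
  epsI : Mi → Mk → Set (HPf F farity)
  eqI : Mi → Mi → Set (HPf F farity)
  natI : Mi → Set (HPf F farity)
  nullI : Mi → Set (HPf F farity)
  epsI_cand : ∀ a c, isCandH (epsI a c)
  eqI_cand : ∀ a b, isCandH (eqI a b)
  natI_cand : ∀ a, isCandH (natI a)
  nullI_cand : ∀ a, isCandH (nullI a)

/-- The domain of a sort in a model. -/
def HDom (M : HModel F farity) : HSort → Type
  | .iota => M.Mi
  | .kappa => M.Mk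

/-- Denotation of a term in a `C`-model. -/
noncomputable def denT (M : HModel F farity) (φi : ℕ → M.Mi) (φk : ℕ → M.Mk) :
    {s : HSort} → HTm F farity s → HDom M s
  | _, .var x => φi x
  | _, .cvar X => φk X
  | _, .zero => M.zeroI
  | _, .succ t => M.succI (denT M φi φk t)
  | _, .add t u => M.addI (denT M φi φk t) (denT M φi φk u)
  | _, .mul t u => M.mulI (denT M φi φk t) (denT M φi φk u)
  | _, .pred t => M.predI (denT M φi φk t)
  | _, .extra g args => M.extraI g (fun i => denT M φi φk (args i))
  | _, .compr x ys A args => M.comprI x ys A (fun i => denT M φi φk (args i))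

/-- Denotation of a proposition in a `C`-model. -/
noncomputable def denF (M : HModel F farity) (φi : ℕ → M.Mi) (φk : ℕ → M.Mk) :
    HFm F farity → Set (HPf F farity)
  | .eps t c => M.epsI (denT M φi φk t) (denT M φi φk c)
  | .eq t u => M.eqI (denT M φi φk t) (denT M φi φk u)
  | .nat t => M.natI (denT M φi φk t)
  | .null t => M.nullI (denT M φi φk t)
  | .top => HSNset F farity
  | .bot => HSNset F farity
  | .and A B => cAndH (denF M φi φk A) (denF M φi φk B)
  | .or A B => cOrH (denF M φi φk A) (denF M φi φk B)
  | .imp A B => cImpH (denF M φi φk A) (denF M φi φk B)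
  | .all x A => cAllH {S | ∃ a : M.Mi, S = denF M (Function.update φi x a) φk A}
  | .ex x A => cExH {S | ∃ a : M.Mi, S = denF M (Function.update φi x a) φk A}
  | .allC X A => cAllH {S | ∃ c : M.Mk, S = denF M φi (Function.update φk X c) A}
  | .exC X A => cExH {S | ∃ c : M.Mk, S = denF M φi (Function.update φk X c) A}

/-- `M` is a `C`-model of the congruence `≡_{HA∪ℰ}`: congruent propositions
have equal denotations under every assignment. -/
def isHModelOf (M : HModel F farity) (E : ESet F farity) : Prop :=
  ∀ A B : HFm F farity, FEq E A B →
    ∀ (φi : ℕ → M.Mi) (φk : ℕ → M.Mk), denF M φi φk A = denF M φi φk B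


/-- The congruence `FEq2` without reflexivity, symmetry and transitivity. -/
inductive SEq (E : ESet F farity) : HFm F farity → HFm F farity → Prop where
  | eps {t t' : HTm F farity .iota} {c c' : HTm F farity .kappa} :
      TEq E t t' → TEq E c c' → SEq E (.eps t c) (.eps t' c')
  | eq {t t' u u' : HTm F farity .iota} :
      TEq E t t' → TEq E u u' → SEq E (.eq t u) (.eq t' u')
  | nat {t t' : HTm F farity .iota} : TEq E t t' → SEq E (.nat t) (.nat t')
  | null {t t' : HTm F farity .iota} : TEq E t t' → SEq E (.null t) (.null t')
  | top : SEq E .top .top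
  | bot : SEq E .bot .bot
  | and {A A' B B' : HFm F farity} :
      SEq E A A' → SEq E B B' → SEq E (.and A B) (.and A' B')
  | or {A A' B B' : HFm F farity} :
      SEq E A A' → SEq E B B' → SEq E (.or A B) (.or A' B')
  | imp {A A' B B' : HFm F farity} :
      SEq E A A' → SEq E B B' → SEq E (.imp A B) (.imp A' B')
  | all (x : ℕ) {A A' : HFm F farity} : SEq E A A' → SEq E (.all x A) (.all x A')
  | ex (x : ℕ) {A A' : HFm F farity} : SEq E A A' → SEq E (.ex x A) (.ex x A')
  | allC (X : ℕ) {A A' : HFm F farity} : SEq E A A' → SEq E (.allC X A) (.allC X A')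
  | exC (X : ℕ) {A A' : HFm F farity} : SEq E A A' → SEq E (.exC X A) (.exC X A')

theorem SEq.rfl' (E : ESet F farity) : ∀ A : HFm F farity, SEq E A A
  | .eps _ _ => .eps (.refl _) (.refl _)
  | .eq _ _ => .eq (.refl _) (.refl _)
  | .nat _ => .nat (.refl _)
  | .null _ => .null (.refl _)
  | .top => .top
  | .bot => .bot
  | .and A B => .and (SEq.rfl' E A) (SEq.rfl' E B)
  | .or A B => .or (SEq.rfl' E A) (SEq.rfl' E B)
  | .imp A B => .imp (SEq.rfl' E A) (SEq.rfl' E B)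
  | .all x A => .all x (SEq.rfl' E A)
  | .ex x A => .ex x (SEq.rfl' E A)
  | .allC x A => .allC x (SEq.rfl' E A)
  | .exC x A => .exC x (SEq.rfl' E A)

theorem SEq.symm' {E : ESet F farity} {A B : HFm F farity} (h : SEq E A B) : SEq E B A := by
  induction h with
  | eps h₁ h₂ => exact .eps h₁.symm h₂.symm
  | eq h₁ h₂ => exact .eq h₁.symm h₂.symm
  | nat h => exact .nat h.symm
  | null h => exact .null h.symm
  | _ => constructor <;> assumption

theorem SEq.trans' {E : ESet F farity} {A B C : HFm F farity} (h : SEq E A B)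
    (h' : SEq E B C) : SEq E A C := by
  induction h generalizing C with
  | eps h₁ h₂ => cases h' with | eps k₁ k₂ => exact .eps (h₁.trans k₁) (h₂.trans k₂)
  | eq h₁ h₂ => cases h' with | eq k₁ k₂ => exact .eq (h₁.trans k₁) (h₂.trans k₂)
  | nat h => cases h' with | nat k => exact .nat (h.trans k)
  | null h => cases h' with | null k => exact .null (h.trans k)
  | top => exact h'
  | bot => exact h'
  | and _ _ i₁ i₂ => cases h' with | and k₁ k₂ => exact .and (i₁ k₁) (i₂ k₂)
  | or _ _ i₁ i₂ => cases h' with | or k₁ k₂ => exact .or (i₁ k₁) (i₂ k₂)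
  | imp _ _ i₁ i₂ => cases h' with | imp k₁ k₂ => exact .imp (i₁ k₁) (i₂ k₂)
  | all x _ i => cases h' with | all _ k => exact .all x (i k)
  | ex x _ i => cases h' with | ex _ k => exact .ex x (i k)
  | allC x _ i => cases h' with | allC _ k => exact .allC x (i k)
  | exC x _ i => cases h' with | exC _ k => exact .exC x (i k)

theorem SEq.of {E : ESet F farity} {A B : HFm F farity} (h : FEq2 E A B) : SEq E A B := by
  induction h with
  | refl A => exact SEq.rfl' E A
  | symm _ i => exact i.symm'
  | trans _ _ i j => exact i.trans' j
  | _ => constructor <;> assumption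

theorem SEq.to {E : ESet F farity} {A B : HFm F farity} (h : SEq E A B) : FEq2 E A B := by
  induction h with
  | eps h₁ h₂ => exact .epsC h₁ h₂
  | eq h₁ h₂ => exact .eqC h₁ h₂
  | nat h => exact .natC h
  | null h => exact .nullC h
  | top => exact .refl _
  | bot => exact .refl _
  | and _ _ i₁ i₂ => exact .andC i₁ i₂
  | or _ _ i₁ i₂ => exact .orC i₁ i₂
  | imp _ _ i₁ i₂ => exact .impC i₁ i₂
  | all x _ i => exact .allC' x i
  | ex x _ i => exact .exC' x i
  | allC x _ i => exact .allCC x i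
  | exC x _ i => exact .exCC x i

theorem localization_aux {E : ESet F farity} {A' B' : HFm F farity} (h : Step1 A' B') :
    ∀ A, SEq E A A' → ∃ (o : Occ) (l r : HFm F farity), HA1Inst l r ∧
      ∃ C, subAt A o = some C ∧ isAtomH C ∧ FEq2 E C l ∧
        ∃ B'', graft A o r = some B'' ∧ FEq2 E B'' B' := by
  induction h with
  | @root l r hr =>
    intro A hA
    refine ⟨.here, l, r, hr, A, by cases A <;> rfl, ?_, hA.to, r, by cases A <;> rfl, .refl _⟩
    cases hr <;> cases hA <;> trivial
  | and₁ B _ ih =>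
    intro A hA
    cases hA with | and h₁ h₂ =>
    obtain ⟨o, l, r, hr, C, hC, hat, hl, B'', hg, hB⟩ := ih _ h₁
    exact ⟨.and1 o, l, r, hr, C, hC, hat, hl, _, by simp [graft, hg], .andC hB h₂.to⟩
  | and₂ B _ ih =>
    intro A hA
    cases hA with | and h₁ h₂ =>
    obtain ⟨o, l, r, hr, C, hC, hat, hl, B'', hg, hB⟩ := ih _ h₂
    exact ⟨.and2 o, l, r, hr, C, hC, hat, hl, _, by simp [graft, hg], .andC h₁.to hB⟩
  | or₁ B _ ih =>
    intro A hA
    cases hA with | or h₁ h₂ =>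
    obtain ⟨o, l, r, hr, C, hC, hat, hl, B'', hg, hB⟩ := ih _ h₁
    exact ⟨.or1 o, l, r, hr, C, hC, hat, hl, _, by simp [graft, hg], .orC hB h₂.to⟩
  | or₂ B _ ih =>
    intro A hA
    cases hA with | or h₁ h₂ =>
    obtain ⟨o, l, r, hr, C, hC, hat, hl, B'', hg, hB⟩ := ih _ h₂
    exact ⟨.or2 o, l, r, hr, C, hC, hat, hl, _, by simp [graft, hg], .orC h₁.to hB⟩
  | imp₁ B _ ih =>
    intro A hA
    cases hA with | imp h₁ h₂ =>
    obtain ⟨o, l, r, hr, C, hC, hat, hl, B'', hg, hB⟩ := ih _ h₁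
    exact ⟨.imp1 o, l, r, hr, C, hC, hat, hl, _, by simp [graft, hg], .impC hB h₂.to⟩
  | imp₂ B _ ih =>
    intro A hA
    cases hA with | imp h₁ h₂ =>
    obtain ⟨o, l, r, hr, C, hC, hat, hl, B'', hg, hB⟩ := ih _ h₂
    exact ⟨.imp2 o, l, r, hr, C, hC, hat, hl, _, by simp [graft, hg], .impC h₁.to hB⟩
  | all x _ ih =>
    intro A hA
    cases hA with | all _ h₁ =>
    obtain ⟨o, l, r, hr, C, hC, hat, hl, B'', hg, hB⟩ := ih _ h₁
    exact ⟨.all o, l, r, hr, C, hC, hat, hl, _, by simp [graft, hg], .allC' x hB⟩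
  | ex x _ ih =>
    intro A hA
    cases hA with | ex _ h₁ =>
    obtain ⟨o, l, r, hr, C, hC, hat, hl, B'', hg, hB⟩ := ih _ h₁
    exact ⟨.ex o, l, r, hr, C, hC, hat, hl, _, by simp [graft, hg], .exC' x hB⟩
  | allC x _ ih =>
    intro A hA
    cases hA with | allC _ h₁ =>
    obtain ⟨o, l, r, hr, C, hC, hat, hl, B'', hg, hB⟩ := ih _ h₁
    exact ⟨.allC o, l, r, hr, C, hC, hat, hl, _, by simp [graft, hg], .allCC x hB⟩
  | exC x _ ih =>
    intro A hA
    cases hA with | exC _ h₁ =>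
    obtain ⟨o, l, r, hr, C, hC, hat, hl, B'', hg, hB⟩ := ih _ h₁
    exact ⟨.exC o, l, r, hr, C, hC, hat, hl, _, by simp [graft, hg], .exCC x hB⟩

/-- localization of the congruence in `→_{HA₁/HA₂∪ℰ}`: if
`A →_{HA₁/HA₂∪ℰ} B` then there is an occurrence `o` of an atomic proposition in
`A`, an instance `l → r` of a proposition rewrite rule of `HA₁` and a
substitution (packaged in `HA1Inst`), with `A_{|o} ≡_{HA₂∪ℰ} l` and
`B ≡_{HA₂∪ℰ} A[r]_o`. -/
theorem localization (F : Type) (farity : F → ℕ) (E : ESet F farity)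
    (A B : HFm F farity) (h : RelMod E A B) :
    ∃ (o : Occ) (l r : HFm F farity), HA1Inst l r ∧
      ∃ C, subAt A o = some C ∧ isAtomH C ∧ FEq2 E C l ∧
        ∃ B', graft A o r = some B' ∧ FEq2 E B' B := by
  obtain ⟨A', B', h₁, h₂, h₃⟩ := h
  obtain ⟨o, l, r, hr, C, hC, hat, hl, B'', hg, hB⟩ := localization_aux h₂ A (SEq.of h₁)
  exact ⟨o, l, r, hr, C, hC, hat, hl, B'', hg, hB.trans h₃⟩

end HAModulo
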